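/- Suppose Assumptions 1–4 below hold (with δ_H ∈ [0,1]), the noise satisfies the second-moment martingale-difference condition, and the step sizes satisfy the appendix step-size assumption. Then for every t ≥ 0, almost surely: E[‖x̂_{t+1}‖² | F_t] ≤ (1 − μ_Fα_t/2)‖x̂_t‖² + ((7L_H L_{G,y})²/(2μ_F))·(β_t²/α_t)·‖ŷ_t‖² + 2Γ₁₁α_t² + 2L_H²Γ₂₂β_t² + (16S_H²Γ₂₂^{1+δ_H}/μ_F)·β_t^{2+2δ_H}/α_t, and E[‖ŷ_{t+1}‖² | F_t] ≤ (1 − μ_Gβ_t/2)‖ŷ_t‖² + (2L_{G,x}²/μ_G)β_t‖x̂_t‖² + Γ₂₂β_t². -/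

import Mathlib

set_option autoImplicit false

open MeasureTheory Filter
open scoped RealInnerProductSpace

noncomputable section

/-- Spectral norm of a rectangular real matrix (the operator norm of the induced
linear map between Euclidean spaces). -/
def specNorm {m n : ℕ} (A : Matrix (Fin m) (Fin n) ℝ) : ℝ :=
  ‖LinearMap.toContinuousLinearMap (Matrix.toEuclideanLin A)‖

/-- The σ-algebra `𝔉 t = σ(x₀, y₀, ξ₀, ψ₀, …, ξ_{t-1}, ψ_{t-1})`. -/
def natFilt {Ω : Type} [MeasurableSpace Ω] {dx dy : ℕ}
    (x0 : Ω → EuclideanSpace ℝ (Fin dx)) (y0 : Ω → EuclideanSpace ℝ (Fin dy))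
    (ξ : ℕ → Ω → EuclideanSpace ℝ (Fin dx)) (ψ : ℕ → Ω → EuclideanSpace ℝ (Fin dy))
    (t : ℕ) : MeasurableSpace Ω :=
  MeasurableSpace.comap x0 inferInstance ⊔ MeasurableSpace.comap y0 inferInstance ⊔
    ⨆ s ∈ Finset.range t,
      (MeasurableSpace.comap (ξ s) inferInstance ⊔ MeasurableSpace.comap (ψ s) inferInstance)

section ConditionalExpectation

variable {Ω : Type*} {m m0 : MeasurableSpace Ω} {μ : Measure Ω}
  {E V : Type*} [NormedAddCommGroup E] [InnerProductSpace ℝ E]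
  [NormedAddCommGroup V] [NormedSpace ℝ V]

lemma MeasureTheory.MemLp.integrable_real_inner {f g : Ω → E} (hf : MemLp f 2 μ)
    (hg : MemLp g 2 μ) : Integrable (fun ω => ⟪f ω, g ω⟫) μ :=
  (hf.norm.integrable_mul hg.norm).mono' (hf.1.inner hg.1)
    (.of_forall fun ω => norm_inner_le_norm (𝕜 := ℝ) (f ω) (g ω))

lemma MeasureTheory.MemLp.integrable_norm_sq {W : Type*} [NormedAddCommGroup W] {f : Ω → W}
    (hf : MemLp f 2 μ) : Integrable (fun ω => ‖f ω‖ ^ 2) μ :=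
  (memLp_two_iff_integrable_sq_norm hf.1).1 hf

/-- Expansion of the conditional second moment of `u - N` when `u` is `m`-measurable. -/
lemma condExp_norm_sub_sq [CompleteSpace E] [IsProbabilityMeasure μ] (hm : m ≤ m0)
    {u N : Ω → E} (hu : StronglyMeasurable[m] u)
    (hu2 : MemLp u 2 μ) (hN2 : MemLp N 2 μ) :
    μ[fun ω => ‖u ω - N ω‖ ^ 2 | m] =ᵐ[μ]
      fun ω => ‖u ω‖ ^ 2 - 2 * ⟪u ω, (μ[N | m]) ω⟫ + (μ[fun ω' => ‖N ω'‖ ^ 2 | m]) ω := by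
  have hI := hu2.integrable_real_inner hN2
  have hexp : (fun ω => ‖u ω - N ω‖ ^ 2) =
      ((fun ω => ‖u ω‖ ^ 2) - (2 : ℝ) • fun ω => ⟪u ω, N ω⟫) + fun ω => ‖N ω‖ ^ 2 := by
    ext ω
    simp [norm_sub_sq_real]
  have hfix : μ[fun ω => ‖u ω‖ ^ 2 | m] = fun ω => ‖u ω‖ ^ 2 :=
    condExp_of_stronglyMeasurable hm (hu.norm.pow 2) hu2.integrable_norm_sq
  rw [hexp]
  filter_upwards [condExp_add (hu2.integrable_norm_sq.sub (hI.smul (2 : ℝ)))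
      hN2.integrable_norm_sq m,
    condExp_sub hu2.integrable_norm_sq (hI.smul (2 : ℝ)) m,
    condExp_smul (2 : ℝ) (fun ω => ⟪u ω, N ω⟫) m (μ := μ),
    condExp_bilin_of_aestronglyMeasurable_left (innerSL ℝ) hu.aestronglyMeasurable hI
      (hN2.integrable one_le_two)] with ω h₁ h₂ h₃ h₄
  simp only [Pi.add_apply, Pi.sub_apply, Pi.smul_apply, smul_eq_mul] at h₁ h₂ h₃
  change (μ[fun ω => ⟪u ω, N ω⟫ | m]) ω = ⟪u ω, (μ[N | m]) ω⟫ at h₄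
  rw [h₁, h₂, h₃, h₄, hfix]

/-- Conditional moments of order `p ≤ 2` are controlled by the conditional second moment. -/
lemma condExp_norm_rpow_le [IsProbabilityMeasure μ] {W : Type*} [NormedAddCommGroup W]
    {ψ : Ω → W} (hψ : MemLp ψ 2 μ)
    {Γ p : ℝ} (hp : 1 ≤ p) (hp2 : p ≤ 2)
    (hΓ : ∀ᵐ ω ∂μ, (μ[fun ω' => ‖ψ ω'‖ ^ 2 | m]) ω ≤ Γ) :
    Integrable (fun ω => ‖ψ ω‖ ^ p) μ ∧
      ∀ᵐ ω ∂μ, (μ[fun ω' => ‖ψ ω'‖ ^ p | m]) ω ≤ Γ ^ (p / 2) := by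
  have hp0 : 0 < p := by linarith
  have hint : Integrable (fun ω => ‖ψ ω‖ ^ p) μ := by
    have := (hψ.mono_exponent (p := ENNReal.ofReal p) (by
      simpa using ENNReal.ofReal_le_ofReal hp2)).integrable_norm_rpow'
    simpa [ENNReal.toReal_ofReal hp0.le] using this
  refine ⟨hint, ?_⟩
  have hpow : (fun ω => ‖‖ψ ω‖ ^ p‖ ^ (2 / p)) = fun ω => ‖ψ ω‖ ^ 2 := by
    ext ω
    rw [Real.norm_of_nonneg (by positivity), ← Real.rpow_mul (norm_nonneg _),
      mul_div_cancel₀ _ hp0.ne', Real.rpow_two]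
  have hJ := Integrable.norm_condExp_rpow_le (m := m) (f := fun ω => ‖ψ ω‖ ^ p) (p := 2 / p)
    ((one_le_div hp0).2 hp2) (by rw [hpow]; exact hψ.integrable_norm_sq)
  rw [hpow] at hJ
  filter_upwards [hJ, hΓ] with ω h₁ h₂
  calc (μ[fun ω' => ‖ψ ω'‖ ^ p | m]) ω ≤ ‖(μ[fun ω' => ‖ψ ω'‖ ^ p | m]) ω‖ := le_abs_self _
    _ = (‖(μ[fun ω' => ‖ψ ω'‖ ^ p | m]) ω‖ ^ (2 / p)) ^ (p / 2) := by
      rw [← Real.rpow_mul (norm_nonneg _), div_mul_div_cancel₀ hp0.ne', div_self two_ne_zero,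
        Real.rpow_one]
    _ ≤ Γ ^ (p / 2) := Real.rpow_le_rpow (by positivity) (h₁.trans h₂) (by positivity)

/-- Conditional bias of a Hölder-smooth map along a centred perturbation. -/
lemma norm_condExp_increment_le [IsProbabilityMeasure μ] [FiniteDimensional ℝ E]
    [FiniteDimensional ℝ V] [MeasurableSpace V] [BorelSpace V] (hm : m ≤ m0)
    {H : V → E} {H' : V → V →L[ℝ] E} (hH' : ∀ y, HasFDerivAt H (H' y) y) {L S δ b Γ : ℝ} (hL : 0 ≤ L)
    (hlip : ∀ y₁ y₂, ‖H y₁ - H y₂‖ ≤ L * ‖y₁ - y₂‖) (hS : 0 ≤ S) (hδ : δ ∈ Set.Icc (0 : ℝ) 1)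
    (htaylor : ∀ y₁ y₂, ‖H y₁ - H y₂ - H' y₂ (y₁ - y₂)‖ ≤ S * ‖y₁ - y₂‖ ^ (1 + δ))
    (hb : 0 ≤ b) {z ψ : Ω → V} (hz : Measurable[m] z) (hψ : MemLp ψ 2 μ)
    (hmean : μ[ψ | m] =ᵐ[μ] 0) (hΓ : ∀ᵐ ω ∂μ, (μ[fun ω' => ‖ψ ω'‖ ^ 2 | m]) ω ≤ Γ) :
    ∀ᵐ ω ∂μ, ‖(μ[fun ω' => H (z ω' - b • ψ ω') - H (z ω') | m]) ω‖ ≤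
      S * b ^ (1 + δ) * Γ ^ ((1 + δ) / 2) := by
  have hHc : Continuous H := continuous_iff_continuousAt.2 fun y => (hH' y).continuousAt
  have hψ1 : Integrable ψ μ := hψ.integrable one_le_two
  have : ProperSpace (V →L[ℝ] E) := FiniteDimensional.proper ℝ _
  borelize E
  have hH'm : StronglyMeasurable[m] fun ω => H' (z ω) := by
    have h : H' = fderiv ℝ H := by ext1 y; exact (hH' y).fderiv.symm
    rw [h]
    exact ((measurable_fderiv ℝ H).comp hz).stronglyMeasurable
  have hzae : AEStronglyMeasurable z μ := (hz.mono hm le_rfl).aestronglyMeasurable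
  have hbound (y : V) : ‖H' y‖ ≤ L := (hH' y).le_of_lip' hL (.of_forall fun x => hlip x y)
  have hΔ : Integrable (fun ω => H (z ω - b • ψ ω) - H (z ω)) μ := by
    refine (hψ1.norm.const_mul (L * b)).mono'
      ((hHc.comp_aestronglyMeasurable (hzae.sub (hψ1.1.const_smul b))).sub
        (hHc.comp_aestronglyMeasurable hzae)) (.of_forall fun ω => ?_)
    refine (hlip _ _).trans_eq ?_
    rw [sub_sub_cancel_left, norm_neg, norm_smul, Real.norm_of_nonneg hb, mul_assoc]
  have hM : Integrable (fun ω => H' (z ω) (ψ ω)) μ := by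
    refine (hψ1.norm.const_mul L).mono'
      (isBoundedBilinearMap_apply.continuous.comp_aestronglyMeasurable
        ((hH'm.mono hm).aestronglyMeasurable.prodMk hψ1.1))
      (.of_forall fun ω => ?_)
    exact (ContinuousLinearMap.le_opNorm _ _).trans (by gcongr; exact hbound _)
  obtain ⟨hpint, hple⟩ := condExp_norm_rpow_le (m := m) (p := 1 + δ) hψ
    (by linarith [hδ.1]) (by linarith [hδ.2]) hΓ
  have hR : ∀ ω, ‖H (z ω - b • ψ ω) - H (z ω) + b • H' (z ω) (ψ ω)‖ ≤
      S * b ^ (1 + δ) * ‖ψ ω‖ ^ (1 + δ) := fun ω => by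
    have h := htaylor (z ω - b • ψ ω) (z ω)
    rw [sub_sub_cancel_left, norm_neg, norm_smul, Real.norm_of_nonneg hb,
      Real.mul_rpow hb (norm_nonneg _), map_neg, map_smul, sub_neg_eq_add, ← mul_assoc] at h
    exact h
  filter_upwards [condExp_add hΔ (hM.smul b) m,
    condExp_smul b (fun ω => H' (z ω) (ψ ω)) m (μ := μ),
    condExp_bilin_of_aestronglyMeasurable_left (.id ℝ (V →L[ℝ] E)) hH'm.aestronglyMeasurable
      hM hψ1, hmean, hple,
    norm_condExp_le (m := m) (μ := μ)
      ((fun ω => H (z ω - b • ψ ω) - H (z ω)) + b • fun ω => H' (z ω) (ψ ω)),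
    condExp_mono (m := m) (hΔ.add (hM.smul b)).norm (hpint.const_mul (S * b ^ (1 + δ)))
      (.of_forall hR),
    condExp_smul (S * b ^ (1 + δ)) (fun ω => ‖ψ ω‖ ^ (1 + δ)) m (μ := μ)]
    with ω h₁ h₂ h₃ h₄ h₅ h₆ h₇ h₈
  have hb0 : 0 ≤ b ^ (1 + δ) := by positivity
  simp only [ContinuousLinearMap.coe_id', id_eq, h₄, Pi.zero_apply, map_zero] at h₃
  rw [Pi.add_apply, h₂, Pi.smul_apply, h₃, smul_zero, add_zero] at h₁
  rw [h₁] at h₆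
  refine h₆.trans (h₇.trans (h₈.trans_le ?_))
  exact mul_le_mul_of_nonneg_left h₅ (by positivity)

end ConditionalExpectation

section Drift

variable {E V : Type*} [NormedAddCommGroup E] [InnerProductSpace ℝ E]
  [NormedAddCommGroup V] [InnerProductSpace ℝ V]

/-- One explicit step along a strongly monotone direction of linear growth is a contraction. -/
lemma norm_sub_smul_sq_le {v w : E} {a c κ L : ℝ} (ha : 0 ≤ a)
    (hmono : κ * ‖v‖ ^ 2 ≤ ⟪v, w⟫) (hlip : ‖w‖ ≤ L * ‖v‖) (hc : a * L ^ 2 ≤ c) :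
    ‖v - a • w‖ ^ 2 ≤ (1 - 2 * a * κ + a * c) * ‖v‖ ^ 2 := by
  rw [norm_sub_sq_real, inner_smul_right, norm_smul, Real.norm_of_nonneg ha]
  have h₁ : ‖w‖ ^ 2 ≤ (L * ‖v‖) ^ 2 := by gcongr
  have h₂ := mul_le_mul_of_nonneg_left hmono ha
  have h₃ := mul_le_mul_of_nonneg_left h₁ (sq_nonneg a)
  have h₄ := mul_le_mul_of_nonneg_right (mul_le_mul_of_nonneg_left hc ha) (sq_nonneg ‖v‖)
  nlinarith

lemma add_sq_le_convex {θ X e : ℝ} (hθ : 0 < θ) (hθ1 : θ ≤ 1) :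
    ((1 - θ) * X + e) ^ 2 ≤ (1 - θ) * X ^ 2 + e ^ 2 / θ := by
  have h : (1 - θ) * X ^ 2 + e ^ 2 / θ - ((1 - θ) * X + e) ^ 2 =
      (1 - θ) * (θ * X - e) ^ 2 / θ := by
    field_simp
    ring
  have : 0 ≤ (1 - θ) * (θ * X - e) ^ 2 / θ :=
    div_nonneg (mul_nonneg (by linarith) (sq_nonneg _)) hθ.le
  linarith

lemma fast_drift_le {s X P D U e : ℝ} (hs : 0 < s) (hs1 : s ≤ 1 / 4) (hX : 0 ≤ X)
    (hP : P ^ 2 ≤ (1 - 7 / 4 * s) * X ^ 2) (hD : D ≤ s / 28 * X + e) (hU0 : 0 ≤ U)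
    (hU : U ≤ P + D) :
    (1 + s / 16) * U ^ 2 ≤ (1 - s / 2) * X ^ 2 + 49 / (2 * s) * e ^ 2 := by
  have hP' : P ≤ (1 - 7 / 8 * s) * X := by
    refine le_of_sq_le_sq ?_ (mul_nonneg (by linarith) hX)
    nlinarith [mul_nonneg (sq_nonneg s) (sq_nonneg X)]
  have hle : U ≤ (1 - 3 / 4 * s) * X + e := by nlinarith [mul_nonneg hs.le hX]
  have hsq : U ^ 2 ≤ (1 - 3 / 4 * s) * X ^ 2 + e ^ 2 / (3 / 4 * s) :=
    (pow_le_pow_left₀ hU0 hle 2).trans (add_sq_le_convex (by linarith) (by linarith))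
  have hdiv : e ^ 2 / (3 / 4 * s) = 4 / 3 * (e ^ 2 / s) := by field_simp
  have hdiv' : 49 / (2 * s) * e ^ 2 = 49 / 2 * (e ^ 2 / s) := by field_simp
  have he : 0 ≤ e ^ 2 / s := by positivity
  rw [hdiv] at hsq
  rw [hdiv']
  nlinarith [mul_le_mul_of_nonneg_left hsq (by linarith : (0 : ℝ) ≤ 1 + s / 16),
    mul_nonneg hs.le (sq_nonneg X), mul_nonneg (sq_nonneg s) (sq_nonneg X),
    mul_nonneg hs.le he, mul_le_mul_of_nonneg_right hs1 he]

lemma slow_drift_le {w Y P Q U : ℝ} (hw : 0 < w) (hw1 : w ≤ 1) (hY : 0 ≤ Y)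
    (hP : P ^ 2 ≤ (1 - w) * Y ^ 2) (hU0 : 0 ≤ U) (hU : U ≤ P + Q) :
    U ^ 2 ≤ (1 - w / 2) * Y ^ 2 + 2 / w * Q ^ 2 := by
  have hP' : P ≤ (1 - w / 2) * Y := by
    refine le_of_sq_le_sq ?_ (mul_nonneg (by linarith) hY)
    nlinarith [mul_nonneg (sq_nonneg w) (sq_nonneg Y)]
  have hsq : U ^ 2 ≤ (1 - w / 2) * Y ^ 2 + Q ^ 2 / (w / 2) :=
    (pow_le_pow_left₀ hU0 (hU.trans (by gcongr)) 2).trans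
      (add_sq_le_convex (by linarith) (by linarith))
  have hdiv : Q ^ 2 / (w / 2) = 2 / w * Q ^ 2 := by field_simp
  rwa [hdiv] at hsq

/-- A strong monotonicity constant is at most the growth constant on a nontrivial space. -/
lemma le_of_monotone_of_growth {v w : E} {κ L : ℝ} (hv : v ≠ 0)
    (hmono : κ * ‖v‖ ^ 2 ≤ ⟪v, w⟫) (hlip : ‖w‖ ≤ L * ‖v‖) : κ ≤ L := by
  have hv0 : 0 < ‖v‖ := norm_pos_iff.2 hv
  have h : ⟪v, w⟫ ≤ ‖v‖ * (L * ‖v‖) :=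
    (real_inner_le_norm v w).trans (by gcongr)
  have : κ * ‖v‖ ^ 2 ≤ L * ‖v‖ ^ 2 := by nlinarith
  exact le_of_mul_le_mul_right this (by positivity)

lemma le_of_monotone_of_growth_all [Nontrivial E] {c : E} {f : E → E} {κ L : ℝ}
    (hmono : ∀ x, κ * ‖x - c‖ ^ 2 ≤ ⟪x - c, f x⟫) (hlip : ∀ x, ‖f x‖ ≤ L * ‖x - c‖) : κ ≤ L := by
  obtain ⟨x, hx⟩ := exists_ne c
  exact le_of_monotone_of_growth (sub_ne_zero.2 hx) (hmono x) (hlip x)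

/-- The conditionally deterministic part of the fast update. -/
lemma norm_fast_drift_sq_le {F : E → V → E} {G : E → V → V} {H : V → E} {ystar : V}
    {LH LF LGx LGy κF κG a b : ℝ} (hLH : 0 ≤ LH) (hLF : 0 < LF) (hLGy : 0 ≤ LGy)
    (hHlip : ∀ y₁ y₂, ‖H y₁ - H y₂‖ ≤ LH * ‖y₁ - y₂‖)
    (hFlip : ∀ x y, ‖F x y‖ ≤ LF * ‖x - H y‖)
    (hGgrowth : ∀ x y, ‖G x y‖ ≤ LGx * ‖x - H y‖ + LGy * ‖y - ystar‖)
    (hGHlip : ∀ y, ‖G (H y) y‖ ≤ LGy * ‖y - ystar‖)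
    (hκF : 0 < κF)
    (hFmono : ∀ x y, κF * ‖x - H y‖ ^ 2 ≤ ⟪x - H y, F x y⟫)
    (hGmono : ∀ y, κG * ‖y - ystar‖ ^ 2 ≤ ⟪y - ystar, G (H y) y⟫)
    (ha : 0 < a) (hb : 0 < b) (haub : a ≤ κF / (4 * LF ^ 2))
    (hba : b * (28 * LH * LGx * max 1 LGy) ≤ a * (κF * κG)) (x : E) (y : V) :
    (1 + κF * a / 16) * ‖(x - H y - a • F x y) - (H (y - b • G x y) - H y)‖ ^ 2 ≤
      (1 - κF * a / 2) * ‖x - H y‖ ^ 2 +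
        (7 * LH * LGy) ^ 2 / (2 * κF) * (b ^ 2 / a) * ‖y - ystar‖ ^ 2 := by
  rcases subsingleton_or_nontrivial E with hE | hE
  · rw [Subsingleton.elim ((x - H y - a • F x y) - (H (y - b • G x y) - H y)) 0,
      Subsingleton.elim (x - H y) 0]
    simp only [norm_zero, ne_eq, OfNat.ofNat_ne_zero, not_false_eq_true, zero_pow, mul_zero,
      zero_add]
    positivity
  have haub' : a * LF ^ 2 ≤ κF / 4 := by
    rw [le_div_iff₀ (by positivity)] at haub
    linarith
  have hκL : κF ≤ LF := le_of_monotone_of_growth_all (fun x => hFmono x y) fun x => hFlip x y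
  have hs : κF * a ≤ 1 / 4 := by
    have h₁ : a * (κF * κF) ≤ a * LF ^ 2 := by
      rw [sq]; gcongr
    have h₂ : κF * (κF * a) ≤ κF * (1 / 4) := by linarith
    exact le_of_mul_le_mul_left h₂ hκF
  have hP := norm_sub_smul_sq_le ha.le (hFmono x y) (hFlip x y) haub'
  have hD : ‖H (y - b • G x y) - H y‖ ≤
      κF * a / 28 * ‖x - H y‖ + LH * LGy * b * ‖y - ystar‖ := by
    rcases subsingleton_or_nontrivial V with hV | hV
    · rw [Subsingleton.elim (y - b • G x y) y, sub_self, norm_zero]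
      positivity
    have hκGL : κG ≤ LGy := le_of_monotone_of_growth_all hGmono hGHlip
    have hmax : 0 < max 1 LGy := lt_max_of_lt_left one_pos
    have hcoef : b * LH * LGx ≤ κF * a / 28 := by
      have h₁ : b * (28 * LH * LGx) * max 1 LGy ≤ a * κF * max 1 LGy := by
        calc b * (28 * LH * LGx) * max 1 LGy = b * (28 * LH * LGx * max 1 LGy) := by ring
          _ ≤ a * (κF * κG) := hba
          _ = a * κF * κG := by ring
          _ ≤ a * κF * max 1 LGy := by gcongr; exact hκGL.trans (le_max_right _ _)
      linarith [le_of_mul_le_mul_right h₁ hmax]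
    calc ‖H (y - b • G x y) - H y‖ ≤ LH * (b * ‖G x y‖) := by
          refine (hHlip _ _).trans_eq ?_
          rw [sub_sub_cancel_left, norm_neg, norm_smul, Real.norm_of_nonneg hb.le]
      _ ≤ LH * (b * (LGx * ‖x - H y‖ + LGy * ‖y - ystar‖)) := by gcongr; exact hGgrowth x y
      _ = b * LH * LGx * ‖x - H y‖ + LH * LGy * b * ‖y - ystar‖ := by ring
      _ ≤ _ := by gcongr
  have h := fast_drift_le (mul_pos hκF ha) hs (norm_nonneg (x - H y))
    (hP.trans_eq (by ring)) hD (norm_nonneg _)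
    (norm_sub_le (x - H y - a • F x y) (H (y - b • G x y) - H y))
  refine h.trans_eq ?_
  congr 1
  field_simp
  ring

/-- The conditionally deterministic part of the slow update. -/
lemma norm_slow_drift_sq_le {X : Type*} [NormedAddCommGroup X] {G : X → V → V}
    {H : V → X} {ystar : V} {LGx LGy κG b : ℝ} (hLGy : 0 < LGy) (hGlipx : ∀ x y, ‖G x y - G (H y) y‖ ≤ LGx * ‖x - H y‖)
    (hGHlip : ∀ y, ‖G (H y) y‖ ≤ LGy * ‖y - ystar‖) (hκG : 0 < κG)
    (hGmono : ∀ y, κG * ‖y - ystar‖ ^ 2 ≤ ⟪y - ystar, G (H y) y⟫)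
    (hb : 0 < b) (hbub : b ≤ κG / LGy ^ 2) (x : X) (y : V) :
    ‖y - ystar - b • G x y‖ ^ 2 ≤
      (1 - κG * b / 2) * ‖y - ystar‖ ^ 2 + 2 * LGx ^ 2 / κG * b * ‖x - H y‖ ^ 2 := by
  rcases subsingleton_or_nontrivial V with hV | hV
  · rw [Subsingleton.elim (y - ystar - b • G x y) 0, Subsingleton.elim (y - ystar) 0]
    simp only [norm_zero, ne_eq, OfNat.ofNat_ne_zero, not_false_eq_true, zero_pow, mul_zero,
      zero_add]
    positivity
  have hbub' : b * LGy ^ 2 ≤ κG := (le_div_iff₀ (by positivity)).1 hbub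
  have hκL : κG ≤ LGy := le_of_monotone_of_growth_all hGmono hGHlip
  have hw : κG * b ≤ 1 := by
    have h₁ : b * (κG * κG) ≤ b * LGy ^ 2 := by
      rw [sq]; gcongr
    have h₂ : κG * (κG * b) ≤ κG * 1 := by linarith
    exact le_of_mul_le_mul_left h₂ hκG
  have hP := norm_sub_smul_sq_le hb.le (hGmono y) (hGHlip y) hbub'
  have hU : ‖y - ystar - b • G x y‖ ≤
      ‖y - ystar - b • G (H y) y‖ + b * (LGx * ‖x - H y‖) := by
    have h : y - ystar - b • G x y =
        (y - ystar - b • G (H y) y) - b • (G x y - G (H y) y) := by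
      rw [smul_sub]; abel
    rw [h]
    refine (norm_sub_le _ _).trans ?_
    rw [norm_smul, Real.norm_of_nonneg hb.le]
    gcongr
    exact hGlipx x y
  refine (slow_drift_le (mul_pos hκG hb) hw (norm_nonneg _) (hP.trans_eq (by ring))
    (norm_nonneg _) hU).trans_eq ?_
  congr 1
  field_simp

end Drift

section Filtration

variable {Ω : Type} [MeasurableSpace Ω] {dx dy : ℕ}
  {x0 : Ω → EuclideanSpace ℝ (Fin dx)} {y0 : Ω → EuclideanSpace ℝ (Fin dy)}
  {ξ : ℕ → Ω → EuclideanSpace ℝ (Fin dx)} {ψ : ℕ → Ω → EuclideanSpace ℝ (Fin dy)}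

lemma natFilt_le (hx0 : Measurable x0) (hy0 : Measurable y0) (hξ : ∀ t, Measurable (ξ t))
    (hψ : ∀ t, Measurable (ψ t)) (t : ℕ) : natFilt x0 y0 ξ ψ t ≤ ‹MeasurableSpace Ω› :=
  sup_le (sup_le hx0.comap_le hy0.comap_le)
    (iSup₂_le fun s _ => sup_le (hξ s).comap_le (hψ s).comap_le)

lemma natFilt_mono : Monotone (natFilt x0 y0 ξ ψ) := fun _ _ hst =>
  sup_le_sup_left (biSup_mono fun _ hi =>
    Finset.mem_range.2 ((Finset.mem_range.1 hi).trans_le hst)) _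

lemma measurable_natFilt_fst (t : ℕ) : Measurable[natFilt x0 y0 ξ ψ t] x0 :=
  (comap_measurable x0).mono (le_sup_left.trans le_sup_left) le_rfl

lemma measurable_natFilt_snd (t : ℕ) : Measurable[natFilt x0 y0 ξ ψ t] y0 :=
  (comap_measurable y0).mono (le_sup_right.trans le_sup_left) le_rfl

lemma comap_noise_le_natFilt {s t : ℕ} (hst : s < t) :
    MeasurableSpace.comap (ξ s) inferInstance ⊔ MeasurableSpace.comap (ψ s) inferInstance ≤
      natFilt x0 y0 ξ ψ t :=
  (le_biSup (fun s => MeasurableSpace.comap (ξ s) inferInstance ⊔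
    MeasurableSpace.comap (ψ s) inferInstance) (Finset.mem_range.2 hst)).trans le_sup_right

lemma measurable_natFilt_noise_fst {s t : ℕ} (hst : s < t) :
    Measurable[natFilt x0 y0 ξ ψ t] (ξ s) :=
  (comap_measurable (ξ s)).mono (le_sup_left.trans (comap_noise_le_natFilt hst)) le_rfl

lemma measurable_natFilt_noise_snd {s t : ℕ} (hst : s < t) :
    Measurable[natFilt x0 y0 ξ ψ t] (ψ s) :=
  (comap_measurable (ψ s)).mono (le_sup_right.trans (comap_noise_le_natFilt hst)) le_rfl

end Filtration

/-- Lemma E.4 (refined one-step descent lemma after Cauchy-Schwarz). -/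
theorem one_step_descent_refined
    {Ω : Type} [MeasurableSpace Ω] (μ : Measure Ω) [IsProbabilityMeasure μ]
    {dx dy : ℕ}
    (F : EuclideanSpace ℝ (Fin dx) → EuclideanSpace ℝ (Fin dy) → EuclideanSpace ℝ (Fin dx))
    (G : EuclideanSpace ℝ (Fin dx) → EuclideanSpace ℝ (Fin dy) → EuclideanSpace ℝ (Fin dy))
    (H : EuclideanSpace ℝ (Fin dy) → EuclideanSpace ℝ (Fin dx))
    (xstar : EuclideanSpace ℝ (Fin dx)) (ystar : EuclideanSpace ℝ (Fin dy))
    (hFroot : F xstar ystar = 0) (hGroot : G xstar ystar = 0)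
    -- Assumption 1
    (LH LF : ℝ) (hLH : 0 ≤ LH) (hLF : 0 ≤ LF)
    (hFH : ∀ y, F (H y) y = 0)
    (hFHuniq : ∀ y x', F x' y = 0 → x' = H y)
    (hHlip : ∀ y₁ y₂, ‖H y₁ - H y₂‖ ≤ LH * ‖y₁ - y₂‖)
    (hFlip : ∀ x' y, ‖F x' y - F (H y) y‖ ≤ LF * ‖x' - H y‖)
    -- Assumption 2
    (LGx LGy : ℝ) (hLGx : 0 ≤ LGx) (hLGy : 0 ≤ LGy)
    (hGlipx : ∀ x' y, ‖G x' y - G (H y) y‖ ≤ LGx * ‖x' - H y‖)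
    (hGlipy : ∀ y, ‖G (H y) y - G (H ystar) ystar‖ ≤ LGy * ‖y - ystar‖)
    -- Assumption 3
    (muF muG : ℝ) (hmuF : 0 < muF) (hmuG : 0 < muG)
    (hFmono : ∀ x' y, muF * ‖x' - H y‖ ^ 2 ≤ ⟪x' - H y, F x' y - F (H y) y⟫)
    (hGmono : ∀ y, muG * ‖y - ystar‖ ^ 2 ≤ ⟪y - ystar, G (H y) y - G (H ystar) ystar⟫)
    -- Assumption 4
    (H' : EuclideanSpace ℝ (Fin dy) → (EuclideanSpace ℝ (Fin dy) →L[ℝ] EuclideanSpace ℝ (Fin dx)))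
    (hH' : ∀ y, HasFDerivAt H (H' y) y)
    (SH dH : ℝ) (hSH : 0 ≤ SH) (hdH : dH ∈ Set.Icc (0 : ℝ) 1)
    (hHtaylor : ∀ y₁ y₂, ‖H y₁ - H y₂ - H' y₂ (y₁ - y₂)‖ ≤ SH * ‖y₁ - y₂‖ ^ (1 + dH))
    -- the two-time-scale stochastic approximation process
    (alpha beta : ℕ → ℝ) (halpha : ∀ t, 0 < alpha t) (hbeta : ∀ t, 0 < beta t)
    (ξ : ℕ → Ω → EuclideanSpace ℝ (Fin dx)) (ψ : ℕ → Ω → EuclideanSpace ℝ (Fin dy))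
    (x : ℕ → Ω → EuclideanSpace ℝ (Fin dx)) (y : ℕ → Ω → EuclideanSpace ℝ (Fin dy))
    (hxupd : ∀ t ω, x (t + 1) ω = x t ω - alpha t • (F (x t ω) (y t ω) + ξ t ω))
    (hyupd : ∀ t ω, y (t + 1) ω = y t ω - beta t • (G (x t ω) (y t ω) + ψ t ω))
    -- measurability
    (hFmeas : Measurable fun p : EuclideanSpace ℝ (Fin dx) × EuclideanSpace ℝ (Fin dy) => F p.1 p.2)
    (hGmeas : Measurable fun p : EuclideanSpace ℝ (Fin dx) × EuclideanSpace ℝ (Fin dy) => G p.1 p.2)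
    (hx0meas : Measurable (x 0)) (hy0meas : Measurable (y 0))
    (hξmeas : ∀ t, Measurable (ξ t)) (hψmeas : ∀ t, Measurable (ψ t))
    -- finite initial second moments
    (hx0L2 : Integrable (fun ω => ‖x 0 ω‖ ^ 2) μ) (hy0L2 : Integrable (fun ω => ‖y 0 ω‖ ^ 2) μ)
    -- noise assumption (martingale differences with bounded second conditional moments)
    (Γ11 Γ22 : ℝ) (hΓ11 : 0 ≤ Γ11) (hΓ22 : 0 ≤ Γ22)
    (hξmean : ∀ t, μ[ξ t | natFilt (x 0) (y 0) ξ ψ t] =ᵐ[μ] 0)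
    (hψmean : ∀ t, μ[ψ t | natFilt (x 0) (y 0) ξ ψ t] =ᵐ[μ] 0)
    (hξ2int : ∀ t, Integrable (fun ω => ‖ξ t ω‖ ^ 2) μ)
    (hψ2int : ∀ t, Integrable (fun ω => ‖ψ t ω‖ ^ 2) μ)
    (hξ2 : ∀ t, ∀ᵐ ω ∂μ, (μ[fun ω' => ‖ξ t ω'‖ ^ 2 | natFilt (x 0) (y 0) ξ ψ t]) ω ≤ Γ11)
    (hψ2 : ∀ t, ∀ᵐ ω ∂μ, (μ[fun ω' => ‖ψ t ω'‖ ^ 2 | natFilt (x 0) (y 0) ξ ψ t]) ω ≤ Γ22)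
    -- appendix step-size assumption
    (hαub : ∀ t, alpha t ≤ muF / (4 * LF ^ 2))
    (hβub : ∀ t, beta t ≤ muG / LGy ^ 2)
    (hκub : ∀ t, beta t / alpha t ≤ min (muF * muG / (28 * LH * LGx * max 1 LGy)) (muF / muG))
    (hρub : ∀ t, beta t ^ 2 / alpha t ≤ muF / (16 * LH ^ 2 * LGx ^ 2))
    (hαgrow : ∀ t, alpha (t + 1) ≤ alpha t ∧
      alpha t / alpha (t + 1) ≤ 1 + min (muF * alpha (t + 1) / 4) (muG * beta (t + 1) / 8))
    (hβgrow : ∀ t, beta (t + 1) ≤ beta t ∧ beta t / beta (t + 1) ≤ 1 + muG * beta (t + 1) / 32)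
 :
    ∀ t : ℕ,
      (∀ᵐ ω ∂μ,
        (μ[fun ω' => ‖x (t + 1) ω' - H (y (t + 1) ω')‖ ^ 2 | natFilt (x 0) (y 0) ξ ψ t]) ω ≤
          (1 - muF * alpha t / 2) * ‖x t ω - H (y t ω)‖ ^ 2 +
          (7 * LH * LGy) ^ 2 / (2 * muF) * (beta t ^ 2 / alpha t) * ‖y t ω - ystar‖ ^ 2 +
          2 * Γ11 * alpha t ^ 2 + 2 * LH ^ 2 * Γ22 * beta t ^ 2 +
          16 * SH ^ 2 * Γ22 ^ (1 + dH) / muF * (beta t ^ (2 + 2 * dH) / alpha t)) ∧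
      (∀ᵐ ω ∂μ,
        (μ[fun ω' => ‖y (t + 1) ω' - ystar‖ ^ 2 | natFilt (x 0) (y 0) ξ ψ t]) ω ≤
          (1 - muG * beta t / 2) * ‖y t ω - ystar‖ ^ 2 +
          2 * LGx ^ 2 / muG * beta t * ‖x t ω - H (y t ω)‖ ^ 2 +
          Γ22 * beta t ^ 2) := by
  intro t
  have hκpos : 0 < muF * muG / (28 * LH * LGx * max 1 LGy) :=
    (div_pos (hbeta t) (halpha t)).trans_le ((hκub t).trans (min_le_left _ _))
  have hden : 0 < 28 * LH * LGx * max 1 LGy :=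
    (div_pos_iff_of_pos_left (mul_pos hmuF hmuG)).1 hκpos
  have hLF0 : 0 < LF := hLF.lt_of_ne' fun h => by
    have := hαub t
    rw [h] at this
    norm_num at this
    exact this.not_gt (halpha t)
  have hLGy0 : 0 < LGy := hLGy.lt_of_ne' fun h => by
    have := hβub t
    rw [h] at this
    norm_num at this
    exact this.not_gt (hbeta t)
  have hba : beta t * (28 * LH * LGx * max 1 LGy) ≤ alpha t * (muF * muG) := by
    have := (hκub t).trans (min_le_left _ _)
    rw [div_le_div_iff₀ (halpha t) hden] at this
    linarith
  have hG0 : G (H ystar) ystar = 0 := by rw [← hFHuniq ystar xstar hFroot, hGroot]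
  simp only [hFH, hG0, sub_zero] at hFlip hGlipy hFmono hGmono
  have hGgrowth (x' y') : ‖G x' y'‖ ≤ LGx * ‖x' - H y'‖ + LGy * ‖y' - ystar‖ := by
    refine (norm_le_norm_sub_add (G x' y') (G (H y') y')).trans ?_
    exact add_le_add (hGlipx x' y') (hGlipy y')
  have hHc : Continuous H := continuous_iff_continuousAt.2 fun y => (hH' y).continuousAt
  have hle := natFilt_le hx0meas hy0meas hξmeas hψmeas
  have hξL2 (s) : MemLp (ξ s) 2 μ :=
    (memLp_two_iff_integrable_sq_norm (hξmeas s).aestronglyMeasurable).2 (hξ2int s)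
  have hψL2 (s) : MemLp (ψ s) 2 μ :=
    (memLp_two_iff_integrable_sq_norm (hψmeas s).aestronglyMeasurable).2 (hψ2int s)
  have hxeq (s) : x (s + 1) = fun ω => x s ω - alpha s • (F (x s ω) (y s ω) + ξ s ω) :=
    funext (hxupd s)
  have hyeq (s) : y (s + 1) = fun ω => y s ω - beta s • (G (x s ω) (y s ω) + ψ s ω) :=
    funext (hyupd s)
  have hmeas (s) : Measurable[natFilt (x 0) (y 0) ξ ψ s] (x s) ∧
      Measurable[natFilt (x 0) (y 0) ξ ψ s] (y s) := by
    induction s with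
    | zero => exact ⟨measurable_natFilt_fst 0, measurable_natFilt_snd 0⟩
    | succ s ih =>
      have hx := ih.1.mono (natFilt_mono s.le_succ) le_rfl
      have hy := ih.2.mono (natFilt_mono s.le_succ) le_rfl
      rw [hxeq, hyeq]
      exact ⟨hx.sub (((hFmeas.comp (hx.prodMk hy)).add
          (measurable_natFilt_noise_fst s.lt_succ_self)).const_smul (alpha s)),
        hy.sub (((hGmeas.comp (hx.prodMk hy)).add
          (measurable_natFilt_noise_snd s.lt_succ_self)).const_smul (beta s))⟩
  have hresid {X : Ω → EuclideanSpace ℝ (Fin dx)} {Y : Ω → EuclideanSpace ℝ (Fin dy)}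
      (hX : MemLp X 2 μ) (hY : MemLp Y 2 μ) : MemLp (fun ω => X ω - H (Y ω)) 2 μ := by
    refine hX.sub (((memLp_const ‖H 0‖).add (hY.norm.const_mul LH)).mono'
      (hHc.comp_aestronglyMeasurable hY.1) (.of_forall fun ω => ?_))
    have h := hHlip (Y ω) 0
    rw [sub_zero] at h
    exact (norm_le_norm_add_norm_sub' _ _).trans (add_le_add_right h _)
  have hFL2 {X : Ω → EuclideanSpace ℝ (Fin dx)} {Y : Ω → EuclideanSpace ℝ (Fin dy)}
      (hXm : Measurable X) (hYm : Measurable Y)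
      (hX : MemLp X 2 μ) (hY : MemLp Y 2 μ) : MemLp (fun ω => F (X ω) (Y ω)) 2 μ :=
    ((hresid hX hY).norm.const_mul LF).mono'
      (hFmeas.comp (hXm.prodMk hYm)).aestronglyMeasurable (.of_forall fun ω => hFlip _ _)
  have hGL2 {X : Ω → EuclideanSpace ℝ (Fin dx)} {Y : Ω → EuclideanSpace ℝ (Fin dy)}
      (hXm : Measurable X) (hYm : Measurable Y)
      (hX : MemLp X 2 μ) (hY : MemLp Y 2 μ) : MemLp (fun ω => G (X ω) (Y ω)) 2 μ :=
    (((hresid hX hY).norm.const_mul LGx).add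
      ((hY.sub (memLp_const ystar)).norm.const_mul LGy)).mono'
      (hGmeas.comp (hXm.prodMk hYm)).aestronglyMeasurable (.of_forall fun ω => hGgrowth _ _)
  have hL2 (s) : MemLp (x s) 2 μ ∧ MemLp (y s) 2 μ := by
    induction s with
    | zero =>
      exact ⟨(memLp_two_iff_integrable_sq_norm hx0meas.aestronglyMeasurable).2 hx0L2,
        (memLp_two_iff_integrable_sq_norm hy0meas.aestronglyMeasurable).2 hy0L2⟩
    | succ s ih =>
      have hxm := (hmeas s).1.mono (hle s) le_rfl
      have hym := (hmeas s).2.mono (hle s) le_rfl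
      rw [hxeq, hyeq]
      exact ⟨ih.1.sub (((hFL2 hxm hym ih.1 ih.2).add (hξL2 s)).const_smul (alpha s)),
        ih.2.sub (((hGL2 hxm hym ih.1 ih.2).add (hψL2 s)).const_smul (beta s))⟩
  obtain ⟨hxm, hym⟩ := hmeas t
  obtain ⟨hxL2, hyL2⟩ := hL2 t
  have hFm : Measurable[natFilt (x 0) (y 0) ξ ψ t] fun ω => F (x t ω) (y t ω) :=
    hFmeas.comp (hxm.prodMk hym)
  have hGm : Measurable[natFilt (x 0) (y 0) ξ ψ t] fun ω => G (x t ω) (y t ω) :=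
    hGmeas.comp (hxm.prodMk hym)
  have hFt := hFL2 (hxm.mono (hle t) le_rfl) (hym.mono (hle t) le_rfl) hxL2 hyL2
  have hGt := hGL2 (hxm.mono (hle t) le_rfl) (hym.mono (hle t) le_rfl) hxL2 hyL2
  have ha := halpha t
  have hb := hbeta t
  have hm := hle t
  set m := natFilt (x 0) (y 0) ξ ψ t
  set z : Ω → EuclideanSpace ℝ (Fin dy) := fun ω => y t ω - beta t • G (x t ω) (y t ω)
  have hzω (ω) : z ω = y t ω - beta t • G (x t ω) (y t ω) := rfl
  have hzm : Measurable[m] z := hym.sub (hGm.const_smul (beta t))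
  have hzL2 : MemLp z 2 μ := hyL2.sub (hGt.const_smul (beta t))
  constructor
  · set u : Ω → EuclideanSpace ℝ (Fin dx) := fun ω =>
      (x t ω - H (y t ω) - alpha t • F (x t ω) (y t ω)) - (H (z ω) - H (y t ω)) with hu
    set Δ : Ω → EuclideanSpace ℝ (Fin dx) := fun ω => H (z ω - beta t • ψ t ω) - H (z ω) with hΔ
    have hHy : Measurable[m] fun ω => H (y t ω) := hHc.measurable.comp hym
    have hHz : Measurable[m] fun ω => H (z ω) := hHc.measurable.comp hzm
    have hum : StronglyMeasurable[m] u :=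
      (((hxm.sub hHy).sub (hFm.const_smul (alpha t))).sub (hHz.sub hHy)).stronglyMeasurable
    have huL2 : MemLp u 2 μ := by
      have h : u = (fun ω => x t ω - H (z ω)) -
          alpha t • fun ω => F (x t ω) (y t ω) := by
        ext1 ω
        simp only [hu, Pi.sub_apply, Pi.smul_apply]
        abel
      rw [h]
      exact (hresid hxL2 hzL2).sub (hFt.const_smul _)
    have hΔb (ω) : ‖Δ ω‖ ≤ LH * beta t * ‖ψ t ω‖ := by
      refine (hHlip _ _).trans_eq ?_
      rw [sub_sub_cancel_left, norm_neg, norm_smul, Real.norm_of_nonneg hb.le, mul_assoc]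
    have hΔL2 : MemLp Δ 2 μ :=
      ((hψL2 t).norm.const_mul (LH * beta t)).mono'
        ((hHc.comp_aestronglyMeasurable (hzL2.sub ((hψL2 t).const_smul (beta t))).1).sub
          (hHc.comp_aestronglyMeasurable hzL2.1)) (.of_forall hΔb)
    have hNL2 : MemLp (alpha t • ξ t + Δ) 2 μ := ((hξL2 t).const_smul _).add hΔL2
    have hbias := norm_condExp_increment_le (μ := μ) hm hH' hLH hHlip hSH hdH hHtaylor hb.le
      hzm (hψL2 t) (hψmean t) (hψ2 t)
    have hupd : (fun ω => ‖x (t + 1) ω - H (y (t + 1) ω)‖ ^ 2) =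
        fun ω => ‖u ω - (alpha t • ξ t + Δ) ω‖ ^ 2 := by
      ext1 ω
      have h : y (t + 1) ω = z ω - beta t • ψ t ω := by
        rw [hyupd, hzω, smul_add]
        abel
      rw [h, hxupd]
      simp only [hu, hΔ, Pi.add_apply, Pi.smul_apply, smul_add]
      congr 2
      abel
    have hNsq (ω) : ‖(alpha t • ξ t + Δ) ω‖ ^ 2 ≤
        2 * alpha t ^ 2 * ‖ξ t ω‖ ^ 2 + 2 * LH ^ 2 * beta t ^ 2 * ‖ψ t ω‖ ^ 2 := by
      have h₁ : ‖(alpha t • ξ t + Δ) ω‖ ≤ alpha t * ‖ξ t ω‖ + LH * beta t * ‖ψ t ω‖ := by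
        refine (norm_add_le _ _).trans (add_le_add (le_of_eq ?_) (hΔb ω))
        rw [Pi.smul_apply, norm_smul, Real.norm_of_nonneg ha.le]
      refine (pow_le_pow_left₀ (norm_nonneg _) h₁ 2).trans ?_
      nlinarith [sq_nonneg (alpha t * ‖ξ t ω‖ - LH * beta t * ‖ψ t ω‖)]
    have hξi := (hξ2int t).smul (2 * alpha t ^ 2)
    have hψi := (hψ2int t).smul (2 * LH ^ 2 * beta t ^ 2)
    rw [hupd]
    filter_upwards [condExp_norm_sub_sq hm hum huL2 hNL2, hbias, hξ2 t, hψ2 t, hξmean t,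
      condExp_add ((hξL2 t).integrable one_le_two |>.smul (alpha t))
        (hΔL2.integrable one_le_two) m,
      condExp_smul (alpha t) (ξ t) m (μ := μ),
      condExp_mono (m := m) hNL2.integrable_norm_sq (hξi.add hψi) (.of_forall hNsq),
      condExp_add hξi hψi m,
      condExp_smul (2 * alpha t ^ 2) (fun ω => ‖ξ t ω‖ ^ 2) m (μ := μ),
      condExp_smul (2 * LH ^ 2 * beta t ^ 2) (fun ω => ‖ψ t ω‖ ^ 2) m (μ := μ)]
      with ω e₁ hbω hξω hψω hξ0 e₂ e₃ hN e₄ e₅ e₆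
    rw [e₁]
    rw [Pi.add_apply, e₃, Pi.smul_apply, hξ0, Pi.zero_apply, smul_zero, zero_add] at e₂
    rw [e₄, Pi.add_apply, e₅, e₆] at hN
    simp only [Pi.smul_apply, smul_eq_mul] at hN
    rw [e₂]
    set r : ℝ := SH * beta t ^ (1 + dH) * Γ22 ^ ((1 + dH) / 2) with hr
    have hdrift := norm_fast_drift_sq_le hLH hLF0 hLGy hHlip hFlip hGgrowth hGlipy hmuF
      hFmono hGmono ha hb (hαub t) hba (x t ω) (y t ω)
    have hcross : -2 * ⟪u ω, (μ[Δ | m]) ω⟫ ≤ 2 * (‖u ω‖ * r) := by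
      have h := (abs_real_inner_le_norm (u ω) ((μ[Δ | m]) ω)).trans
        (mul_le_mul_of_nonneg_left hbω (norm_nonneg _))
      linarith [neg_abs_le (⟪u ω, (μ[Δ | m]) ω⟫)]
    have hyoung : 2 * (‖u ω‖ * r) ≤ muF * alpha t / 16 * ‖u ω‖ ^ 2 +
        16 * r ^ 2 / (muF * alpha t) := by
      have hs : 0 < muF * alpha t := mul_pos hmuF ha
      have h : muF * alpha t / 16 * ‖u ω‖ ^ 2 + 16 * r ^ 2 / (muF * alpha t) -
          2 * (‖u ω‖ * r) =
          (muF * alpha t * ‖u ω‖ - 16 * r) ^ 2 / (16 * (muF * alpha t)) := by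
        field_simp
        ring
      have : 0 ≤ (muF * alpha t * ‖u ω‖ - 16 * r) ^ 2 / (16 * (muF * alpha t)) := by positivity
      linarith
    have hr2 : 16 * r ^ 2 / (muF * alpha t) =
        16 * SH ^ 2 * Γ22 ^ (1 + dH) / muF * (beta t ^ (2 + 2 * dH) / alpha t) := by
      have h₁ : (beta t ^ (1 + dH)) ^ 2 = beta t ^ (2 + 2 * dH) := by
        rw [← Real.rpow_mul_natCast hb.le]
        congr 1
        push_cast
        ring
      have h₂ : (Γ22 ^ ((1 + dH) / 2)) ^ 2 = Γ22 ^ (1 + dH) := by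
        rw [← Real.rpow_mul_natCast hΓ22]
        congr 1
        push_cast
        ring
      rw [hr, mul_pow, mul_pow, h₁, h₂]
      field_simp
    have hξb := mul_le_mul_of_nonneg_left hξω (by positivity : 0 ≤ 2 * alpha t ^ 2)
    have hψb := mul_le_mul_of_nonneg_left hψω (by positivity : 0 ≤ 2 * LH ^ 2 * beta t ^ 2)
    have hdrift' : (1 + muF * alpha t / 16) * ‖u ω‖ ^ 2 ≤ _ := hdrift
    rw [hr2] at hyoung
    linarith
  · have hvm : StronglyMeasurable[m] fun ω => z ω - ystar :=
      (hzm.sub measurable_const).stronglyMeasurable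
    have hvL2 : MemLp (fun ω => z ω - ystar) 2 μ := hzL2.sub (memLp_const _)
    have hupd : (fun ω => ‖y (t + 1) ω - ystar‖ ^ 2) =
        fun ω => ‖z ω - ystar - (beta t • ψ t) ω‖ ^ 2 := by
      ext1 ω
      rw [hyupd, hzω, Pi.smul_apply, smul_add]
      congr 2
      abel
    have hNsq : (fun ω => ‖(beta t • ψ t) ω‖ ^ 2) = beta t ^ 2 • fun ω => ‖ψ t ω‖ ^ 2 := by
      ext1 ω
      simp [norm_smul, mul_pow]
    rw [hupd]
    filter_upwards [condExp_norm_sub_sq hm hvm hvL2 ((hψL2 t).const_smul (beta t)), hψ2 t,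
      hψmean t, condExp_smul (beta t) (ψ t) m (μ := μ),
      condExp_smul (beta t ^ 2) (fun ω => ‖ψ t ω‖ ^ 2) m (μ := μ)] with ω e₁ hψω hψ0 e₂ e₃
    rw [e₁, e₂, Pi.smul_apply, hψ0, Pi.zero_apply, smul_zero, inner_zero_right, hNsq, e₃,
      Pi.smul_apply, smul_eq_mul]
    have hdrift := norm_slow_drift_sq_le hLGy0 hGlipx hGlipy hmuG hGmono hb (hβub t)
      (x t ω) (y t ω)
    have hv : z ω - ystar = y t ω - ystar - beta t • G (x t ω) (y t ω) := by
      rw [hzω]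
      abel
    rw [← hv] at hdrift
    linarith [mul_le_mul_of_nonneg_left hψω (sq_nonneg (beta t))]
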